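/- There exists a constant c > 0 such that for every measurable f: R^n → [0,1] and every t > 0, the function h_t = Φ^{-1} ∘ (P_t f) satisfies ||∇h_t(x)|| ≤ c e^{-t}/sqrt(1 - e^{-2t}) for all x, i.e. h_t is Lipschitz with a dimension-free constant depending only on t. -/

import Mathlib

open MeasureTheory Real Filter
open scoped ENNReal NNReal

noncomputable def stdGaussian (n : ℕ) : Measure (Fin n → ℝ) :=
  Measure.pi fun _ => ProbabilityTheory.gaussianReal 0 1

noncomputable def gaussPhi (x : ℝ) : ℝ := (Real.sqrt (2 * Real.pi))⁻¹ * Real.exp (-(x ^ 2) / 2)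

noncomputable def gaussCdf (x : ℝ) : ℝ := ∫ y in Set.Iic x, gaussPhi y

noncomputable def gaussCdfInv : ℝ → ℝ := Function.invFun gaussCdf

/-- The Gaussian isoperimetric function `I = φ ∘ Φ⁻¹`, extended by `I(0) = I(1) = 0`. -/
noncomputable def isoI (a : ℝ) : ℝ := if a ≤ 0 ∨ 1 ≤ a then 0 else gaussPhi (gaussCdfInv a)

/-- Ornstein-Uhlenbeck semigroup. -/
noncomputable def OU (n : ℕ) (t : ℝ) (f : (Fin n → ℝ) → ℝ) (x : Fin n → ℝ) : ℝ :=
  ∫ y, f (fun i => Real.exp (-t) * x i + Real.sqrt (1 - Real.exp (-2 * t)) * y i) ∂(stdGaussian n)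

/-- Partial derivative in direction `i`. -/
noncomputable def pd {n : ℕ} (i : Fin n) (f : (Fin n → ℝ) → ℝ) (x : Fin n → ℝ) : ℝ :=
  fderiv ℝ f x (Pi.single i 1)

/-- Second partial derivative. -/
noncomputable def pd2 {n : ℕ} (i j : Fin n) (f : (Fin n → ℝ) → ℝ) (x : Fin n → ℝ) : ℝ :=
  pd j (pd i f) x

/-- Euclidean norm of the gradient. -/
noncomputable def gradNorm {n : ℕ} (f : (Fin n → ℝ) → ℝ) (x : Fin n → ℝ) : ℝ :=
  Real.sqrt (∑ i, (pd i f x) ^ 2)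

/-- Frobenius norm of the Hessian. -/
noncomputable def hessFrob {n : ℕ} (f : (Fin n → ℝ) → ℝ) (x : Fin n → ℝ) : ℝ :=
  Real.sqrt (∑ i, ∑ j, (pd2 i j f x) ^ 2)

noncomputable def frob {n : ℕ} (A : Matrix (Fin n) (Fin n) ℝ) : ℝ :=
  Real.sqrt (∑ i, ∑ j, (A i j) ^ 2)

/-- One-dimensional Hermite polynomial (physicists'/probabilists' unnormalized, as in the paper). -/
noncomputable def hermite1 (k : ℕ) (x : ℝ) : ℝ :=
  Real.exp (x ^ 2 / 2) * iteratedDeriv k (fun y => Real.exp (-(y ^ 2) / 2)) x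

/-- Multi-dimensional Hermite polynomial. -/
noncomputable def hermiteM {n : ℕ} (α : Fin n → ℕ) (x : Fin n → ℝ) : ℝ :=
  ∏ i, hermite1 (α i) (x i)

/-- Orthonormal Hermite polynomial. -/
noncomputable def hermiteG {n : ℕ} (α : Fin n → ℕ) (x : Fin n → ℝ) : ℝ :=
  hermiteM α x / Real.sqrt (∏ i, Nat.factorial (α i))

/-- `M` is a median of `f` under `μ`. -/
def IsMedian {Ω : Type*} [MeasurableSpace Ω] (μ : Measure Ω) (f : Ω → ℝ) (M : ℝ) : Prop :=
  (1 : ℝ≥0∞) / 2 ≤ μ {x | f x ≤ M} ∧ (1 : ℝ≥0∞) / 2 ≤ μ {x | M ≤ f x}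

/-- Gaussian boundary measure (perimeter), via smooth vector fields all of whose
derivatives vanish at infinity. -/
noncomputable def gaussBoundary (n : ℕ) (A : Set (Fin n → ℝ)) : ℝ :=
  sSup { r : ℝ | ∃ v : (Fin n → ℝ) → (Fin n → ℝ),
    ContDiff ℝ (⊤ : ℕ∞) v ∧
    (∀ k : ℕ, Tendsto (fun x => ‖iteratedFDeriv ℝ k v x‖) (cocompact _) (nhds 0)) ∧
    (∀ x, Real.sqrt (∑ i, (v x i) ^ 2) ≤ 1) ∧
    r = ∫ x in A, (∑ i, (pd i (fun y => v y i) x - x i * v x i)) ∂(stdGaussian n) }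

open ProbabilityTheory in
lemma gaussPhi_eq_gaussianPDFReal (x : ℝ) : gaussPhi x = gaussianPDFReal 0 1 x := by
  simp [gaussPhi, gaussianPDFReal]

open ProbabilityTheory in
lemma gaussCdf_eq_real (x : ℝ) : gaussCdf x = (gaussianReal 0 1).real (Set.Iic x) := by
  simp_rw [gaussCdf, gaussPhi_eq_gaussianPDFReal]
  rw [measureReal_def, gaussianReal_apply_eq_integral _ one_ne_zero,
    ENNReal.toReal_ofReal (integral_nonneg fun _ => gaussianPDFReal_nonneg _ _ _)]

lemma integrable_gaussPhi : Integrable gaussPhi := by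
  rw [funext gaussPhi_eq_gaussianPDFReal]
  exact ProbabilityTheory.integrable_gaussianPDFReal 0 1

lemma gaussPhi_pos (x : ℝ) : 0 < gaussPhi x := by
  unfold gaussPhi
  positivity

lemma continuous_gaussPhi : Continuous gaussPhi := by
  unfold gaussPhi
  fun_prop

lemma gaussCdf_sub_gaussCdf (x y : ℝ) : gaussCdf y - gaussCdf x = ∫ z in x..y, gaussPhi z :=
  intervalIntegral.integral_Iic_sub_Iic integrable_gaussPhi.integrableOn
    integrable_gaussPhi.integrableOn

lemma strictMono_gaussCdf : StrictMono gaussCdf := fun x y hxy => by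
  rw [← sub_pos, gaussCdf_sub_gaussCdf]
  exact intervalIntegral.intervalIntegral_pos_of_pos
    (continuous_gaussPhi.intervalIntegrable _ _) gaussPhi_pos hxy

lemma continuous_gaussCdf : Continuous gaussCdf := by
  have h : gaussCdf = fun y => gaussCdf 0 + ∫ z in (0 : ℝ)..y, gaussPhi z := by
    ext y
    rw [← gaussCdf_sub_gaussCdf]
    ring
  rw [h]
  exact continuous_const.add
    (intervalIntegral.continuous_primitive (fun a b => continuous_gaussPhi.intervalIntegrable a b) 0)

lemma gaussCdf_gaussCdfInv {p : ℝ} (h0 : 0 < p) (h1 : p < 1) : gaussCdf (gaussCdfInv p) = p := by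
  have hcdf : gaussCdf = ProbabilityTheory.cdf (ProbabilityTheory.gaussianReal 0 1) := by
    ext x
    rw [gaussCdf_eq_real, ProbabilityTheory.cdf_eq_real]
  have hbot : Tendsto gaussCdf atBot (nhds 0) := hcdf ▸ ProbabilityTheory.tendsto_cdf_atBot _
  have htop : Tendsto gaussCdf atTop (nhds 1) := hcdf ▸ ProbabilityTheory.tendsto_cdf_atTop _
  obtain ⟨a, ha⟩ := (hbot.eventually_lt_const h0).exists
  obtain ⟨b, hb⟩ := (htop.eventually_const_lt h1).exists
  exact Function.invFun_eq (mem_range_of_exists_le_of_exists_ge continuous_gaussCdf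
    ⟨a, ha.le⟩ ⟨b, hb.le⟩)

instance isProbabilityMeasure_stdGaussian (n : ℕ) : IsProbabilityMeasure (stdGaussian n) := by
  unfold stdGaussian
  infer_instance

/-- A linear functional with unit coefficient vector is standard Gaussian under `stdGaussian n`. -/
lemma map_sum_mul_stdGaussian {n : ℕ} {u : Fin n → ℝ} (hu : ∑ i, u i ^ 2 = 1) :
    (stdGaussian n).map (fun y => ∑ i, u i * y i) = ProbabilityTheory.gaussianReal 0 1 := by
  have hm : Measurable fun y : Fin n → ℝ => ∑ i, u i * y i := by fun_prop
  have : IsProbabilityMeasure ((stdGaussian n).map (fun y => ∑ i, u i * y i)) :=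
    Measure.isProbabilityMeasure_map hm.aemeasurable
  refine Measure.ext_of_charFun ?_
  ext t
  rw [charFun_apply_real, integral_map hm.aemeasurable (by fun_prop), stdGaussian]
  simp_rw [Complex.ofReal_sum, Finset.mul_sum, Finset.sum_mul, Complex.exp_sum]
  rw [integral_fintype_prod_eq_prod
    (f := fun i (x : ℝ) => Complex.exp ((t : ℂ) * ((u i * x : ℝ) : ℂ) * Complex.I))]
  have h (i : Fin n) : ∫ x : ℝ, Complex.exp ((t : ℂ) * ((u i * x : ℝ) : ℂ) * Complex.I)
      ∂(ProbabilityTheory.gaussianReal 0 1) = Complex.exp (-(t ^ 2 / 2) * (u i ^ 2 : ℝ)) := by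
    have := charFun_apply_real (μ := ProbabilityTheory.gaussianReal 0 1) (t * u i)
    rw [ProbabilityTheory.charFun_gaussianReal] at this
    calc _ = _ := by
          congr 1
          ext x
          push_cast
          ring_nf
      _ = _ := this.symm
      _ = _ := by
          congr 1
          push_cast
          ring
  simp_rw [h]
  rw [← Complex.exp_sum, ← Finset.mul_sum, ← Complex.ofReal_sum, hu,
    ProbabilityTheory.charFun_gaussianReal]
  congr 1
  push_cast
  ring

lemma stdGaussian_real_halfspace {n : ℕ} {u : Fin n → ℝ} (hu : ∑ i, u i ^ 2 = 1) (s : ℝ) :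
    (stdGaussian n).real {y | -s ≤ ∑ i, u i * y i} = gaussCdf s := by
  have hu' : ∑ i, (-u i) ^ 2 = 1 := by simpa using hu
  rw [gaussCdf_eq_real, ← map_sum_mul_stdGaussian hu', map_measureReal_apply (by fun_prop)
    measurableSet_Iic]
  congr 1
  ext y
  simp [Finset.sum_neg_distrib, neg_le]

lemma pi_withDensity {ι : Type*} [Fintype ι] {α : ι → Type*} [∀ i, MeasurableSpace (α i)]
    (μ : ∀ i, Measure (α i)) [∀ i, IsProbabilityMeasure (μ i)] {f : ∀ i, α i → ℝ≥0∞}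
    (hf : ∀ i, Measurable (f i)) [∀ i, SigmaFinite ((μ i).withDensity (f i))] :
    Measure.pi (fun i => (μ i).withDensity (f i)) =
      (Measure.pi μ).withDensity (fun x => ∏ i, f i (x i)) := by
  classical
  refine Measure.pi_eq fun s hs => ?_
  have hms (i : ι) : Measurable ((s i).indicator (f i)) := (hf i).indicator (hs i)
  rw [withDensity_apply _ (MeasurableSet.univ_pi hs),
    ← lintegral_indicator (MeasurableSet.univ_pi hs)]
  have h : (Set.univ.pi s).indicator (fun x => ∏ i, f i (x i)) =
      fun x => ∏ i, (s i).indicator (f i) (x i) := by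
    ext x
    by_cases hx : x ∈ Set.univ.pi s
    · rw [Set.indicator_of_mem hx]
      exact Finset.prod_congr rfl fun i _ => (Set.indicator_of_mem (hx i trivial) _).symm
    · rw [Set.indicator_of_notMem hx]
      obtain ⟨i, hi⟩ : ∃ i, x i ∉ s i := by simpa [Set.mem_pi] using hx
      exact (Finset.prod_eq_zero (Finset.mem_univ i) (Set.indicator_of_notMem hi _)).symm
  rw [h, ProbabilityTheory.lintegral_prod_eq_prod_lintegral_of_indepFun Finset.univ
    (fun i (x : ∀ i, α i) => (s i).indicator (f i) (x i))
    (ProbabilityTheory.iIndepFun_pi fun i => (hms i).aemeasurable)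
    (fun i => (hms i).comp (measurable_pi_apply i))]
  refine Finset.prod_congr rfl fun i _ => ?_
  rw [withDensity_apply _ (hs i), ← lintegral_indicator (hs i),
    (measurePreserving_eval μ i).lintegral_comp (hms i)]

open ProbabilityTheory in
lemma gaussianReal_one_eq_withDensity (m : ℝ) :
    gaussianReal m 1 =
      (gaussianReal 0 1).withDensity (fun x => ENNReal.ofReal (exp (m * x - m ^ 2 / 2))) := by
  rw [gaussianReal_of_var_ne_zero _ one_ne_zero, gaussianReal_of_var_ne_zero _ one_ne_zero,
    ← withDensity_mul _ (measurable_gaussianPDF _ _) (by fun_prop)]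
  congr 1
  ext x
  rw [Pi.mul_apply, gaussianPDF, gaussianPDF,
    ← ENNReal.ofReal_mul (gaussianPDFReal_nonneg _ _ _), gaussianPDFReal, gaussianPDFReal,
    mul_assoc _ (exp _), ← exp_add]
  congr 3
  push_cast
  ring

/-- The Cameron–Martin formula for `stdGaussian n`. -/
lemma map_add_stdGaussian {n : ℕ} (w : Fin n → ℝ) :
    (stdGaussian n).map (fun y => y + w) = (stdGaussian n).withDensity
      (fun y => ENNReal.ofReal (exp (∑ i, w i * y i - (∑ i, w i ^ 2) / 2))) := by
  have hmap : (stdGaussian n).map (fun y => y + w) =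
      Measure.pi fun i => ProbabilityTheory.gaussianReal (w i) 1 := by
    unfold stdGaussian
    have h (i : Fin n) : (ProbabilityTheory.gaussianReal 0 1).map (fun x => x + w i) =
        ProbabilityTheory.gaussianReal (w i) 1 := by
      rw [ProbabilityTheory.gaussianReal_map_add_const, zero_add]
    have hσ (i : Fin n) :
        SigmaFinite ((ProbabilityTheory.gaussianReal 0 1).map (fun x => x + w i)) := by
      rw [h]
      infer_instance
    simp_rw [← h]
    exact Measure.pi_map_pi (f := fun i x => x + w i) fun i => by fun_prop
  have hσ (i : Fin n) : SigmaFinite ((ProbabilityTheory.gaussianReal 0 1).withDensity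
      (fun x => ENNReal.ofReal (exp (w i * x - w i ^ 2 / 2)))) := by
    rw [← gaussianReal_one_eq_withDensity]
    infer_instance
  rw [hmap]
  simp_rw [gaussianReal_one_eq_withDensity (w _)]
  rw [pi_withDensity _ fun i => by fun_prop]
  unfold stdGaussian
  congr 1
  ext y
  rw [← ENNReal.ofReal_prod_of_nonneg fun i _ => (exp_pos _).le, ← exp_sum,
    Finset.sum_sub_distrib, Finset.sum_div]

lemma integrable_exp_stdGaussian {n : ℕ} (w : Fin n → ℝ) :
    Integrable (fun y => exp (∑ i, w i * y i - (∑ i, w i ^ 2) / 2)) (stdGaussian n) := by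
  have hfin : IsProbabilityMeasure ((stdGaussian n).map (fun y => y + w)) :=
    Measure.isProbabilityMeasure_map (by fun_prop)
  rw [map_add_stdGaussian] at hfin
  refine ⟨Measurable.aestronglyMeasurable (by fun_prop), ?_⟩
  rw [hasFiniteIntegral_iff_ofReal (ae_of_all _ fun _ => (exp_pos _).le),
    ← setLIntegral_univ, ← withDensity_apply _ MeasurableSet.univ]
  exact measure_lt_top _ _

lemma integral_add_stdGaussian {n : ℕ} (w : Fin n → ℝ) {g : (Fin n → ℝ) → ℝ}
    (hg : Measurable g) :
    ∫ y, g (y + w) ∂(stdGaussian n) =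
      ∫ y, exp (∑ i, w i * y i - (∑ i, w i ^ 2) / 2) * g y ∂(stdGaussian n) := by
  rw [← integral_map (φ := fun y => y + w) (by fun_prop) hg.aestronglyMeasurable,
    map_add_stdGaussian, integral_withDensity_eq_integral_toReal_smul (by fun_prop)
      (ae_of_all _ fun _ => ENNReal.ofReal_lt_top)]
  simp_rw [ENNReal.toReal_ofReal (exp_pos _).le, smul_eq_mul]

/-- Among `[0,1]`-valued functions of given Gaussian mean, translation in a unit direction
increases the mean of half-spaces the most. -/
lemma integral_add_smul_le_gaussCdf {n : ℕ} {u : Fin n → ℝ} (hu : ∑ i, u i ^ 2 = 1) {r : ℝ}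
    (hr : 0 ≤ r) {g : (Fin n → ℝ) → ℝ} (hg : Measurable g) (hg01 : ∀ y, g y ∈ Set.Icc (0 : ℝ) 1)
    {s : ℝ} (hs : ∫ y, g y ∂(stdGaussian n) = gaussCdf s) :
    ∫ y, g (y + r • u) ∂(stdGaussian n) ≤ gaussCdf (s + r) := by
  set γ := stdGaussian n
  set A : Set (Fin n → ℝ) := {y | -s ≤ ∑ i, u i * y i} with hA
  have hAm : MeasurableSet A := measurableSet_le (by fun_prop) (by fun_prop)
  set χ : (Fin n → ℝ) → ℝ := A.indicator 1 with hχ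
  have hχm : Measurable χ := measurable_one.indicator hAm
  have hχ01 (y) : χ y ∈ Set.Icc (0 : ℝ) 1 := by
    by_cases hy : y ∈ A <;> simp [hχ, hy]
  set L : (Fin n → ℝ) → ℝ :=
    fun y => exp (∑ i, (r • u) i * y i - (∑ i, (r • u) i ^ 2) / 2) with hL
  set k : ℝ := exp (r * (-s) - r ^ 2 / 2)
  have hLr (y : Fin n → ℝ) : L y = exp (r * ∑ i, u i * y i - r ^ 2 / 2) := by
    simp [hL, mul_pow, mul_assoc, ← Finset.mul_sum, hu]
  have hbdd {q : (Fin n → ℝ) → ℝ} (hq : ∀ y, q y ∈ Set.Icc (0 : ℝ) 1) (y) : ‖q y‖ ≤ 1 := by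
    rw [norm_eq_abs, abs_le]
    exact ⟨by linarith [(hq y).1], (hq y).2⟩
  have hint {q : (Fin n → ℝ) → ℝ} (hqm : Measurable q) (hq : ∀ y, q y ∈ Set.Icc (0 : ℝ) 1) :
      Integrable q γ :=
    Integrable.of_bound hqm.aestronglyMeasurable 1 (ae_of_all _ (hbdd hq))
  have hLint {q : (Fin n → ℝ) → ℝ} (hqm : Measurable q) (hq : ∀ y, q y ∈ Set.Icc (0 : ℝ) 1) :
      Integrable (fun y => L y * q y) γ :=
    (integrable_exp_stdGaussian (r • u)).mul_bdd hqm.aestronglyMeasurable (ae_of_all _ (hbdd hq))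
  have hχint : ∫ y, χ y ∂γ = gaussCdf s := by
    rw [hχ, integral_indicator_one hAm, stdGaussian_real_halfspace hu]
  have hχshift : ∫ y, χ (y + r • u) ∂γ = gaussCdf (s + r) := by
    rw [← stdGaussian_real_halfspace hu, ← integral_indicator_one
      (measurableSet_le (by fun_prop) (by fun_prop))]
    congr 1
    ext y
    have : ∑ i, u i * (y + r • u) i = ∑ i, u i * y i + r := by
      simp only [Pi.add_apply, Pi.smul_apply, smul_eq_mul, mul_add, Finset.sum_add_distrib]
      simp_rw [mul_left_comm, ← sq]
      rw [← Finset.mul_sum, hu, mul_one]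
    have hiff : y + r • u ∈ A ↔ y ∈ {y | -(s + r) ≤ ∑ i, u i * y i} := by
      simp only [hA, Set.mem_ofPred_eq, this]
      constructor <;> intro h <;> linarith
    by_cases hy : y + r • u ∈ A
    · rw [Set.indicator_of_mem (hiff.1 hy), hχ, Set.indicator_of_mem hy]
      rfl
    · rw [Set.indicator_of_notMem (mt hiff.2 hy), hχ, Set.indicator_of_notMem hy]
  have hpt (y) : L y * g y - L y * χ y ≤ k * (g y - χ y) := by
    by_cases hy : y ∈ A
    · have hk : k ≤ L y := by
        rw [hLr]
        have : r * (-s) ≤ r * ∑ i, u i * y i := mul_le_mul_of_nonneg_left hy hr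
        exact exp_le_exp.2 (by linarith)
      have : χ y = 1 := by simp [hχ, hy]
      rw [this]
      nlinarith [(hg01 y).2]
    · have hk : L y ≤ k := by
        rw [hLr]
        have : r * ∑ i, u i * y i ≤ r * (-s) := mul_le_mul_of_nonneg_left (not_le.1 hy).le hr
        exact exp_le_exp.2 (by linarith)
      have : χ y = 0 := by simp [hχ, hy]
      rw [this]
      nlinarith [(hg01 y).1]
  have hmono := integral_mono ((hLint hg hg01).sub (hLint hχm hχ01))
    (((hint hg hg01).sub (hint hχm hχ01)).const_mul k) hpt
  simp only [Pi.sub_apply] at hmono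
  rw [integral_const_mul, integral_sub (hLint hg hg01) (hLint hχm hχ01),
    integral_sub (hint hg hg01) (hint hχm hχ01), hs, hχint, sub_self, mul_zero,
    ← integral_add_stdGaussian _ hg, ← integral_add_stdGaussian _ hχm, hχshift] at hmono
  linarith

lemma integral_add_stdGaussian_eq_zero {n : ℕ} {g : (Fin n → ℝ) → ℝ} (hg : Measurable g)
    (hg01 : ∀ y, g y ∈ Set.Icc (0 : ℝ) 1) (h0 : ∫ y, g y ∂(stdGaussian n) = 0)
    (w : Fin n → ℝ) : ∫ y, g (y + w) ∂(stdGaussian n) = 0 := by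
  have hint : Integrable g (stdGaussian n) :=
    Integrable.of_bound hg.aestronglyMeasurable 1 (ae_of_all _ fun y => by
      rw [norm_eq_abs, abs_le]
      exact ⟨by linarith [(hg01 y).1], (hg01 y).2⟩)
  have hae := (integral_eq_zero_iff_of_nonneg (fun y => (hg01 y).1) hint).1 h0
  rw [integral_add_stdGaussian w hg]
  refine integral_eq_zero_of_ae ?_
  filter_upwards [hae] with y hy
  simp [hy]

section OrnsteinUhlenbeck

variable {n : ℕ} {f : (Fin n → ℝ) → ℝ} {t : ℝ}

lemma OU_add (hσ : 0 < √(1 - exp (-2 * t))) (x v : Fin n → ℝ) :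
    OU n t f (x + v) = ∫ y, f (fun i => exp (-t) * x i + √(1 - exp (-2 * t)) *
      (y + (exp (-t) / √(1 - exp (-2 * t))) • v) i) ∂(stdGaussian n) := by
  unfold OU
  congr 1
  ext y
  congr 1
  ext i
  have h : √(1 - exp (-2 * t)) * (exp (-t) / √(1 - exp (-2 * t))) = exp (-t) :=
    mul_div_cancel₀ _ hσ.ne'
  simp only [Pi.add_apply, Pi.smul_apply, smul_eq_mul]
  linear_combination -(v i) * h

lemma OU_mem_Icc (hf01 : ∀ x, f x ∈ Set.Icc (0 : ℝ) 1) (x : Fin n → ℝ) :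
    OU n t f x ∈ Set.Icc (0 : ℝ) 1 := by
  refine ⟨integral_nonneg fun y => (hf01 _).1, ?_⟩
  have := integral_mono_of_nonneg (μ := stdGaussian n) (ae_of_all _ fun y => (hf01
    (fun i => exp (-t) * x i + √(1 - exp (-2 * t)) * y i)).1) (integrable_const (1 : ℝ))
    (ae_of_all _ fun y => (hf01 _).2)
  simpa [OU] using this

lemma OU_one_sub (hf : Measurable f) (hf01 : ∀ x, f x ∈ Set.Icc (0 : ℝ) 1) (x : Fin n → ℝ) :
    OU n t (fun z => 1 - f z) x = 1 - OU n t f x := by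
  unfold OU
  rw [integral_sub (integrable_const 1)]
  · simp
  · exact Integrable.of_bound (hf.comp (by fun_prop)).aestronglyMeasurable 1
      (ae_of_all _ fun y => by
        rw [norm_eq_abs, abs_le]
        exact ⟨by linarith [(hf01 (fun i => exp (-t) * x i + √(1 - exp (-2 * t)) * y i)).1],
          (hf01 _).2⟩)

lemma OU_eq_zero_of_eq_zero (hσ : 0 < √(1 - exp (-2 * t))) (hf : Measurable f)
    (hf01 : ∀ x, f x ∈ Set.Icc (0 : ℝ) 1) {x : Fin n → ℝ} (hx : OU n t f x = 0)
    (z : Fin n → ℝ) : OU n t f z = 0 := by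
  rw [← add_sub_cancel x z, OU_add hσ]
  exact integral_add_stdGaussian_eq_zero
    (g := fun y => f (fun i => exp (-t) * x i + √(1 - exp (-2 * t)) * y i))
    (hf.comp (by fun_prop)) (fun y => hf01 _) hx _

lemma OU_eq_one_of_eq_one (hσ : 0 < √(1 - exp (-2 * t))) (hf : Measurable f)
    (hf01 : ∀ x, f x ∈ Set.Icc (0 : ℝ) 1) {x : Fin n → ℝ} (hx : OU n t f x = 1)
    (z : Fin n → ℝ) : OU n t f z = 1 := by
  have h := OU_eq_zero_of_eq_zero (f := fun z => 1 - f z) hσ (measurable_const.sub hf)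
    (fun y => ⟨by linarith [(hf01 y).2], by linarith [(hf01 y).1]⟩)
    (x := x) (by rw [OU_one_sub hf hf01, hx, sub_self]) z
  rw [OU_one_sub hf hf01] at h
  linarith

lemma gaussCdfInv_OU_add_smul_le (hσ : 0 < √(1 - exp (-2 * t))) (hf : Measurable f)
    (hf01 : ∀ x, f x ∈ Set.Icc (0 : ℝ) 1) (hOU : ∀ x, OU n t f x ∈ Set.Ioo (0 : ℝ) 1)
    {u : Fin n → ℝ} (hu : ∑ i, u i ^ 2 = 1) {r : ℝ} (hr : 0 ≤ r) (x : Fin n → ℝ) :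
    gaussCdfInv (OU n t f (x + r • u)) ≤
      gaussCdfInv (OU n t f x) + exp (-t) / √(1 - exp (-2 * t)) * r := by
  rw [← strictMono_gaussCdf.le_iff_le, gaussCdf_gaussCdfInv (hOU _).1 (hOU _).2, OU_add hσ,
    smul_smul]
  exact integral_add_smul_le_gaussCdf
    (g := fun y => f (fun i => exp (-t) * x i + √(1 - exp (-2 * t)) * y i)) hu (by positivity)
    (hf.comp (by fun_prop)) (fun y => hf01 _) (gaussCdf_gaussCdfInv (hOU x).1 (hOU x).2).symm

end OrnsteinUhlenbeck

/-- One-sided Lipschitz control along unit directions bounds the Euclidean gradient. -/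
lemma gradNorm_le_of_add_smul_le {n : ℕ} {h : (Fin n → ℝ) → ℝ} {C : ℝ} (hC : 0 ≤ C)
    (hlip : ∀ u : Fin n → ℝ, ∑ i, u i ^ 2 = 1 → ∀ r, 0 ≤ r → ∀ x, h (x + r • u) ≤ h x + C * r)
    (x : Fin n → ℝ) : gradNorm h x ≤ C := by
  by_cases hd : DifferentiableAt ℝ h x
  swap
  · simpa [gradNorm, pd, fderiv_zero_of_not_differentiableAt hd] using hC
  have hdir (u : Fin n → ℝ) (hu : ∑ i, u i ^ 2 = 1) : fderiv ℝ h x u ≤ C := by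
    have hder : HasDerivAt (fun r : ℝ => h (x + r • u)) (fderiv ℝ h x u) 0 :=
      hd.hasFDerivAt.hasLineDerivAt u
    have hu' : ∑ i, (-u) i ^ 2 = 1 := by simpa using hu
    refine (le_norm_self _).trans (hder.le_of_lip' hC (Eventually.of_forall fun r => ?_))
    simp only [zero_smul, add_zero, sub_zero, norm_eq_abs]
    rw [abs_le]
    rcases le_total 0 r with hr | hr
    · have h1 := hlip u hu r hr x
      have h2 := hlip (-u) hu' r hr (x + r • u)
      rw [smul_neg, add_neg_cancel_right] at h2
      rw [abs_of_nonneg hr]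
      constructor <;> linarith
    · have h1 := hlip (-u) hu' (-r) (neg_nonneg.2 hr) x
      have h2 := hlip u hu (-r) (neg_nonneg.2 hr) (x + r • u)
      rw [neg_smul, add_neg_cancel_right] at h2
      rw [smul_neg, neg_smul, neg_neg] at h1
      rw [abs_of_nonpos hr]
      constructor <;> linarith
  rcases (Real.sqrt_nonneg (∑ i, pd i h x ^ 2)).eq_or_lt with h0 | hpos
  · rw [gradNorm, ← h0]
    exact hC
  set N := √(∑ i, pd i h x ^ 2) with hN
  have hN2 : ∑ i, pd i h x ^ 2 = N ^ 2 :=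
    (Real.sq_sqrt (Finset.sum_nonneg fun i _ => sq_nonneg _)).symm
  have hunit : ∑ i, (N⁻¹ * pd i h x) ^ 2 = 1 := by
    simp_rw [mul_pow]
    rw [← Finset.mul_sum, hN2]
    field_simp
  have happ : fderiv ℝ h x (fun i => N⁻¹ * pd i h x) = N := by
    rw [← ContinuousLinearMap.coe_coe, LinearMap.pi_apply_eq_sum_univ]
    have hs (i : Fin n) : (fun j => if i = j then (1 : ℝ) else 0) = Pi.single i 1 := by
      ext j
      simp [Pi.single_apply, eq_comm]
    simp_rw [hs, smul_eq_mul]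
    change ∑ i, N⁻¹ * pd i h x * pd i h x = N
    simp_rw [mul_assoc, ← sq]
    rw [← Finset.mul_sum, hN2]
    field_simp
  calc gradNorm h x = N := rfl
    _ ≤ C := happ ▸ hdir _ hunit

/-- dimension-free Lipschitz bound for `h_t = Φ⁻¹ ∘ P_t f`. -/
theorem stmt3 :
    ∃ c : ℝ, 0 < c ∧ ∀ (n : ℕ) (f : (Fin n → ℝ) → ℝ), Measurable f →
      (∀ x, f x ∈ Set.Icc (0 : ℝ) 1) →
      ∀ t : ℝ, 0 < t → ∀ x : Fin n → ℝ,
        gradNorm (fun y => gaussCdfInv (OU n t f y)) x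
          ≤ c * Real.exp (-t) / Real.sqrt (1 - Real.exp (-2 * t)) := by
  refine ⟨1, one_pos, fun n f hf hf01 t ht x => ?_⟩
  have hσ : 0 < √(1 - exp (-2 * t)) :=
    Real.sqrt_pos.2 (sub_pos.2 (exp_lt_one_iff.2 (by linarith)))
  have hC : 0 ≤ exp (-t) / √(1 - exp (-2 * t)) := by positivity
  rw [one_mul]
  have hconst (p : ℝ) (hp : ∀ z, OU n t f z = p) :
      gradNorm (fun y => gaussCdfInv (OU n t f y)) x ≤ exp (-t) / √(1 - exp (-2 * t)) := by
    simpa [gradNorm, pd, hp] using hC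
  by_cases h0 : ∃ z, OU n t f z = 0
  · obtain ⟨z, hz⟩ := h0
    exact hconst 0 (OU_eq_zero_of_eq_zero hσ hf hf01 hz)
  by_cases h1 : ∃ z, OU n t f z = 1
  · obtain ⟨z, hz⟩ := h1
    exact hconst 1 (OU_eq_one_of_eq_one hσ hf hf01 hz)
  push Not at h0 h1
  have hOU (z) : OU n t f z ∈ Set.Ioo (0 : ℝ) 1 :=
    ⟨(OU_mem_Icc hf01 z).1.lt_of_ne' (h0 z), (OU_mem_Icc hf01 z).2.lt_of_ne (h1 z)⟩
  exact gradNorm_le_of_add_smul_le hC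
    (fun u hu r hr y => gaussCdfInv_OU_add_smul_le hσ hf hf01 hOU hu hr y) x
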